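/- arXiv:math/0607238 — 5 statements merged into one kernel-verified Lean document; each statement's English description precedes it below -/
import Mathlib

section
/- If n−1 is a prime power, then there exist integers a_1,...,a_n such that the differences a_i − a_j for i ≠ j, taken mod n²−n+1, form exactly all the nonzero residues mod n²−n+1. -/
open Polynomial in
/-- A degree three extension of finite fields: independence, scalars, and a generator. -/
lemma singer_field (q : ℕ) (h : IsPrimePow q) :
    ∃ (K L : Type) (_ : Field K) (_ : Finite K) (_ : Field L) (_ : Finite L) (_ : Algebra K L)
      (t : L), Nat.card K = q ∧ Nat.card L = q ^ 3 ∧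
      (∀ x : L, x ^ q = x → ∃ c : K, algebraMap K L c = x) ∧
      (∀ a b c : K, algebraMap K L a * t ^ 2 + algebraMap K L b * t + algebraMap K L c = 0 →
        a = 0 ∧ b = 0 ∧ c = 0) := by
  obtain ⟨p, k, hp, hk, rfl⟩ := h
  have : Fact p.Prime := ⟨hp.nat_prime⟩
  let K := GaloisField p k
  let L := FiniteField.Extension K p 3
  let pb := Field.powerBasisOfFiniteOfSeparable K L
  have hd : pb.dim = 3 := by
    rw [← pb.finrank, FiniteField.finrank_extension]
  have hK : Nat.card K = p ^ k := GaloisField.card p k hk.ne'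
  refine ⟨K, L, inferInstance, inferInstance, inferInstance, inferInstance, inferInstance,
    pb.gen, hK, ?_, ?_, ?_⟩
  · rw [FiniteField.natCard_extension, hK]
  · intro x hx
    have := (IsGalois.mem_range_algebraMap_iff_fixed (F := K) (E := L) x).2 (by
      intro f
      obtain ⟨i, -, rfl⟩ := FiniteField.Extension.exists_frob_pow_eq K p 3 f
      rw [FiniteField.Extension.frob_iterate_apply, hK]
      induction i with
      | zero => simp
      | succ i ih => rw [pow_succ (p ^ k) i, pow_mul, ih, hx])
    exact this
  · intro a b c habc
    have hP : (C a * X ^ 2 + C b * X + C c : K[X]) = 0 := by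
      by_contra hne
      have h1 := pb.dim_le_natDegree_of_root hne (by simpa using habc)
      have h2 : (C a * X ^ 2 + C b * X + C c : K[X]).natDegree ≤ 2 := natDegree_quadratic_le
      omega
    refine ⟨?_, ?_, ?_⟩
    · simpa [coeff_X, coeff_C] using congrArg (fun P => coeff P 2) hP
    · simpa [coeff_X, coeff_C] using congrArg (fun P => coeff P 1) hP
    · simpa [coeff_X, coeff_C] using congrArg (fun P => coeff P 0) hP

/-- The points of the Singer line. -/
def singerPt {K L : Type} [Field K] [Field L] [Algebra K L] (t : L) : Option K → L
  | none => 1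
  | some a => t + algebraMap K L a

set_option maxHeartbeats 1000000 in
lemma singer_unique {K L : Type} [Field K] [Field L] [Algebra K L] (t : L)
    (ht : ∀ a b c : K, algebraMap K L a * t ^ 2 + algebraMap K L b * t + algebraMap K L c = 0 →
        a = 0 ∧ b = 0 ∧ c = 0) (i j k l : Option K) (c : K) (hc : c ≠ 0)
    (h : singerPt t i * singerPt t l = algebraMap K L c * (singerPt t k * singerPt t j)) :
    (i = k ∧ l = j) ∨ (i = j ∧ l = k) := by
  -- coefficients of the difference of both sides
  have key : ∀ x y z : K, algebraMap K L x * t ^ 2 + algebraMap K L y * t + algebraMap K L z =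
      singerPt t i * singerPt t l - algebraMap K L c * (singerPt t k * singerPt t j) →
      x = 0 ∧ y = 0 ∧ z = 0 := fun x y z hh => ht x y z (by rw [hh, h, sub_self])
  rcases i with _ | i <;> rcases j with _ | j <;> rcases k with _ | k <;> rcases l with _ | l <;>
    simp only [singerPt] at key
  · simp
  · have := key 0 1 (l - c) (by simp; ring)
    simp at this
  · have := key 0 (-c) (1 - c * k) (by simp; ring)
    simp [hc] at this
  · obtain ⟨-, h1, h2⟩ := key 0 (1 - c) (l - c * k) (by simp; ring)
    have : c = 1 := by grind
    subst this
    have : l = k := by grind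
    simp [this]
  · have := key 0 (-c) (1 - c * j) (by simp; ring)
    simp [hc] at this
  · obtain ⟨-, h1, h2⟩ := key 0 (1 - c) (l - c * j) (by simp; ring)
    have : c = 1 := by grind
    subst this
    have : l = j := by grind
    simp [this]
  · have := key (-c) (-c * (k + j)) (1 - c * (k * j)) (by simp; ring)
    simp [hc] at this
  · have := key (-c) (1 - c * (k + j)) (l - c * (k * j)) (by simp; ring)
    simp [hc] at this
  · have := key 0 1 (i - c) (by simp; ring)
    simp at this
  · have := key 1 (i + l) (i * l - c) (by simp; ring)
    simp at this
  · obtain ⟨-, h1, h2⟩ := key 0 (1 - c) (i - c * k) (by simp; ring)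
    have : c = 1 := by grind
    subst this
    have : i = k := by grind
    simp [this]
  · have := key 1 (i + l - c) (i * l - c * k) (by simp; ring)
    simp at this
  · obtain ⟨-, h1, h2⟩ := key 0 (1 - c) (i - c * j) (by simp; ring)
    have : c = 1 := by grind
    subst this
    have : i = j := by grind
    simp [this]
  · have := key 1 (i + l - c) (i * l - c * j) (by simp; ring)
    simp at this
  · have := key (-c) (1 - c * (k + j)) (i - c * (k * j)) (by simp; ring)
    simp [hc] at this
  · obtain ⟨h0, h1, h2⟩ := key (1 - c) (i + l - c * (k + j)) (i * l - c * (k * j))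
      (by simp; ring)
    have : c = 1 := by grind
    subst this
    have h3 : (i - k) * (i - j) = 0 := by linear_combination i * h1 - h2
    rcases mul_eq_zero.1 h3 with h3 | h3
    · left
      have e1 : i = k := sub_eq_zero.1 h3
      have e2 : l = j := by linear_combination h1 - h3
      exact ⟨congrArg some e1, congrArg some e2⟩
    · right
      have e1 : i = j := sub_eq_zero.1 h3
      have e2 : l = k := by linear_combination h1 - h3
      exact ⟨congrArg some e1, congrArg some e2⟩

theorem singer_theorem (n : ℕ) (h : IsPrimePow (n - 1)) :
    ∃ a : Fin n → ℤ, ∀ r : ZMod (n ^ 2 - n + 1), r ≠ 0 →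
      ∃! p : Fin n × Fin n, p.1 ≠ p.2 ∧
        ((a p.1 - a p.2 : ℤ) : ZMod (n ^ 2 - n + 1)) = r := by
  obtain ⟨q, rfl⟩ : ∃ q, n = q + 1 := ⟨n - 1, by have := h.two_le; omega⟩
  simp only [Nat.add_sub_cancel] at h
  have hq := h.two_le
  obtain ⟨K, L, _, _, _, _, _, t, hK, hL, hfix, hind⟩ := singer_field q h
  have hN : (q + 1) ^ 2 - (q + 1) + 1 = q ^ 2 + q + 1 := by
    have : (q + 1) ^ 2 = q ^ 2 + q + (q + 1) := by ring
    omega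
  generalize hNdef : (q + 1) ^ 2 - (q + 1) + 1 = N at *
  have : NeZero N := ⟨by omega⟩
  have hcard : Nat.card (Option K) = q + 1 := by rw [Finite.card_option, hK]
  let e : Fin (q + 1) ≃ Option K := (Finite.equivFinOfCardEq hcard).symm
  obtain ⟨g, hg⟩ := IsCyclic.exists_generator (α := Lˣ)
  have hne : ∀ i : Option K, singerPt t i ≠ 0 := by
    rintro (_ | a) h0
    · simp [singerPt] at h0
    · have := hind 0 1 a (by simpa [singerPt] using h0)
      simp at this
  have hlog : ∀ i : Option K, ∃ m : ℤ, ((g ^ m : Lˣ) : L) = singerPt t i := by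
    intro i
    obtain ⟨m, hm⟩ := Subgroup.mem_zpowers_iff.1 (hg (Units.mk0 _ (hne i)))
    exact ⟨m, by rw [hm]; rfl⟩
  choose b hb using hlog
  have hgN : ∀ m : ℤ, ∃ c : K, c ≠ 0 ∧ algebraMap K L c = ((g ^ ((N : ℤ) * m) : Lˣ) : L) := by
    intro m
    have h1 : g ^ (N * (q - 1)) = 1 := by
      have : N * (q - 1) = Nat.card Lˣ := by
        rw [Nat.card_units, hL, hN]
        obtain ⟨s, rfl⟩ : ∃ s, q = s + 1 := ⟨q - 1, by omega⟩
        simp only [Nat.add_sub_cancel]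
        apply Nat.eq_sub_of_add_eq
        ring
      rw [this]
      exact pow_card_eq_one'
    have h2 : (g ^ ((N : ℤ) * m)) ^ q = g ^ ((N : ℤ) * m) := by
      have h3 : (g ^ ((N : ℤ) * m)) ^ (q - 1) = 1 := by
        rw [← zpow_natCast, ← zpow_mul,
          show (N : ℤ) * m * ((q - 1 : ℕ) : ℤ) = ((N * (q - 1) : ℕ) : ℤ) * m by push_cast; ring,
          zpow_mul, zpow_natCast, h1, one_zpow]
      conv_lhs => rw [show q = (q - 1) + 1 by omega]
      rw [pow_succ, h3, one_mul]
    obtain ⟨c, hc⟩ := hfix ((g ^ ((N : ℤ) * m) : Lˣ) : L) (by rw [← Units.val_pow_eq_pow_val, h2])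
    refine ⟨c, ?_, hc⟩
    rintro rfl
    rw [map_zero] at hc
    exact (Units.ne_zero _) hc.symm
  have huniq : ∀ i j k l : Option K, ((b i - b j : ℤ) : ZMod N) = ((b k - b l : ℤ) : ZMod N) →
      (i = k ∧ l = j) ∨ (i = j ∧ l = k) := by
    intro i j k l hh
    rw [ZMod.intCast_eq_intCast_iff_dvd_sub] at hh
    obtain ⟨m, hm⟩ := hh
    obtain ⟨c, hc, hcm⟩ := hgN (-m)
    refine singer_unique t hind i j k l c hc ?_
    rw [hcm, ← hb, ← hb, ← hb, ← hb, ← Units.val_mul, ← Units.val_mul, ← Units.val_mul,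
      ← zpow_add, ← zpow_add, ← zpow_add]
    congr 2
    linarith
  let f : {p : Fin (q + 1) × Fin (q + 1) // p.1 ≠ p.2} → {r : ZMod N // r ≠ 0} := fun p =>
    ⟨((b (e p.1.1) - b (e p.1.2) : ℤ) : ZMod N), fun h0 => by
      have := huniq (e p.1.1) (e p.1.2) (e p.1.1) (e p.1.1) (by rw [h0]; simp)
      have hp := p.2
      have h4 : e p.1.1 = e p.1.2 := by
        rcases this with h | h
        · exact h.2
        · exact h.1
      exact hp (e.injective h4)⟩
  have hf : Function.Injective f := by
    rintro ⟨⟨i, j⟩, hij⟩ ⟨⟨k, l⟩, hkl⟩ hh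
    have h5 := huniq _ _ _ _ (congrArg Subtype.val hh)
    rcases h5 with h5 | h5
    · have h6 := e.injective h5.1
      have h7 := e.injective h5.2
      simp only at h6 h7
      subst h6 h7
      rfl
    · exact absurd (e.injective h5.1) hij
  have hcards : Fintype.card {p : Fin (q + 1) × Fin (q + 1) // p.1 ≠ p.2} =
      Fintype.card {r : ZMod N // r ≠ 0} := by
    have h8 : Fintype.card {r : ZMod N // r ≠ 0} = N - 1 := by
      rw [Fintype.card_subtype_compl, ZMod.card, Fintype.card_subtype_eq]
    have h9 : Fintype.card {p : Fin (q + 1) × Fin (q + 1) // p.1 ≠ p.2} =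
        (q + 1) * (q + 1) - (q + 1) := by
      rw [Fintype.card_subtype]
      have := Finset.offDiag_card (Finset.univ : Finset (Fin (q + 1)))
      rw [Finset.card_univ, Fintype.card_fin] at this
      rw [← this]
      congr 1
      ext; simp
    rw [h8, h9, ← hNdef, sq, Nat.add_sub_cancel]
  have hbij := (Fintype.bijective_iff_injective_and_card f).2 ⟨hf, hcards⟩
  refine ⟨fun i => b (e i), fun r hr => ?_⟩
  obtain ⟨p, hp⟩ := hbij.2 ⟨r, hr⟩
  refine ⟨p.1, ⟨p.2, congrArg Subtype.val hp⟩, ?_⟩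
  rintro p' ⟨hp1, hp2⟩
  have : f ⟨p', hp1⟩ = f p := by
    rw [hp]
    exact Subtype.ext hp2
  exact congrArg Subtype.val (hf this)
end

section
/- If n−1 is a prime power, then the infimum over unimodular n-tuples (z_1,...,z_n), |z_k| = 1, of max_{ν=1,...,n²−n} |∑_{k=1}^n z_k^ν| equals √(n−1). -/
open ComplexConjugate in
lemma aux_double_sum {n : ℕ} (K : ℕ) (z : Fin n → ℂ) :
    ∑ a ∈ Finset.range K, ∑ b ∈ Finset.range K, ‖∑ k, z k ^ a * conj (z k) ^ b‖ ^ 2 =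
      ∑ j, ∑ k, ‖∑ a ∈ Finset.range K, (z j * conj (z k)) ^ a‖ ^ 2 := by
  have key : ∀ w : ℂ, ((‖w‖ ^ 2 : ℝ) : ℂ) = w * conj w := fun w => by
    rw [Complex.mul_conj, Complex.normSq_eq_norm_sq]
  apply Complex.ofReal_injective
  simp only [Complex.ofReal_sum, key, map_sum, map_mul, map_pow, Complex.conj_conj,
    Finset.sum_mul_sum]
  calc _ = ∑ a ∈ Finset.range K, ∑ j, ∑ k, ∑ b ∈ Finset.range K, 
        (z j ^ a * conj (z j) ^ b) * (conj (z k) ^ a * z k ^ b) := by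
        refine Finset.sum_congr rfl fun a _ => ?_
        rw [Finset.sum_comm]
        refine Finset.sum_congr rfl fun j _ => ?_
        rw [Finset.sum_comm]
    _ = _ := by
        rw [Finset.sum_comm]
        refine Finset.sum_congr rfl fun j _ => ?_
        rw [Finset.sum_comm]
        refine Finset.sum_congr rfl fun k _ => ?_
        refine Finset.sum_congr rfl fun a _ => ?_
        refine Finset.sum_congr rfl fun b _ => ?_
        ring

open ComplexConjugate in
lemma aux_norm_sub {n : ℕ} (z : Fin n → ℂ) (hz : ∀ k, ‖z k‖ = 1) (b d : ℕ) :
    ‖∑ k, z k ^ (b + d) * conj (z k) ^ b‖ = ‖∑ k, z k ^ d‖ := by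
  congr 1
  refine Finset.sum_congr rfl fun k _ => ?_
  have h1 : z k * conj (z k) = 1 := by
    rw [Complex.mul_conj, Complex.normSq_eq_norm_sq, hz]; simp
  calc _ = (z k * conj (z k)) ^ b * z k ^ d := by ring
    _ = _ := by rw [h1]; simp

open ComplexConjugate in
lemma aux_norm_sub' {n : ℕ} (z : Fin n → ℂ) (hz : ∀ k, ‖z k‖ = 1) (b d : ℕ) :
    ‖∑ k, z k ^ b * conj (z k) ^ (b + d)‖ = ‖∑ k, z k ^ d‖ := by
  rw [← aux_norm_sub z hz b d, ← Complex.norm_conj]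
  simp [mul_comm]

open ComplexConjugate in
lemma aux_lower {n : ℕ} (hn : 2 ≤ n) (z : Fin n → ℂ) (hz : ∀ k, ‖z k‖ = 1) (M : ℝ)
    (hM : ∀ ν ∈ Finset.Icc 1 (n ^ 2 - n), ‖∑ k, z k ^ ν‖ ≤ M) :
    (n : ℝ) - 1 ≤ M ^ 2 := by
  obtain ⟨N, hN⟩ : ∃ N, N = n ^ 2 - n := ⟨_, rfl⟩
  rw [← hN] at hM
  have hNR : (N : ℝ) = (n : ℝ) ^ 2 - n := by
    rw [hN, Nat.cast_sub (by nlinarith)]; push_cast; ring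
  have hid := aux_double_sum (N + 1) z
  have hR : (n : ℝ) * (N + 1) ^ 2 ≤
      ∑ j, ∑ k, ‖∑ a ∈ Finset.range (N + 1), (z j * conj (z k)) ^ a‖ ^ 2 := by
    calc (n : ℝ) * (N + 1) ^ 2 = ∑ j : Fin n, ((N : ℝ) + 1) ^ 2 := by simp
      _ ≤ _ := by
        refine Finset.sum_le_sum fun j _ => ?_
        have : ((N : ℝ) + 1) ^ 2 =
            ‖∑ a ∈ Finset.range (N + 1), (z j * conj (z j)) ^ a‖ ^ 2 := by
          have h1 : z j * conj (z j) = 1 := by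
            rw [Complex.mul_conj, Complex.normSq_eq_norm_sq, hz]; simp
          rw [h1]
          simp only [one_pow, Finset.sum_const, Finset.card_range, nsmul_eq_mul, mul_one,
            Complex.norm_natCast]
          push_cast; ring
        rw [this]
        exact Finset.single_le_sum
          (f := fun k => ‖∑ a ∈ Finset.range (N + 1), (z j * conj (z k)) ^ a‖ ^ 2)
          (fun k _ => by positivity) (Finset.mem_univ j)
  have hL : ∑ a ∈ Finset.range (N + 1), ∑ b ∈ Finset.range (N + 1),
      ‖∑ k, z k ^ a * conj (z k) ^ b‖ ^ 2 ≤ ((N : ℝ) + 1) * (n ^ 2 + N * M ^ 2) := by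
    calc _ ≤ ∑ a ∈ Finset.range (N + 1), ((n : ℝ) ^ 2 + N * M ^ 2) := by
          refine Finset.sum_le_sum fun a ha => ?_
          rw [← Finset.add_sum_erase _ _ ha]
          refine add_le_add ?_ ?_
          · have := aux_norm_sub z hz a 0
            simp only [add_zero] at this
            rw [this]; simp
          · calc _ ≤ ∑ b ∈ (Finset.range (N + 1)).erase a, M ^ 2 := by
                  refine Finset.sum_le_sum fun b hb => ?_
                  have hb1 := Finset.mem_erase.1 hb
                  have hb2 := Finset.mem_range.1 hb1.2
                  have ha2 := Finset.mem_range.1 ha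
                  refine pow_le_pow_left₀ (norm_nonneg _) ?_ 2
                  rcases lt_or_gt_of_ne hb1.1 with h | h
                  · obtain ⟨d, rfl⟩ := Nat.exists_eq_add_of_lt h
                    rw [add_assoc, aux_norm_sub z hz]
                    exact hM _ (Finset.mem_Icc.2 ⟨by omega, by omega⟩)
                  · obtain ⟨d, rfl⟩ := Nat.exists_eq_add_of_lt h
                    rw [add_assoc, aux_norm_sub' z hz]
                    exact hM _ (Finset.mem_Icc.2 ⟨by omega, by omega⟩)
              _ = _ := by
                  rw [Finset.sum_const, Finset.card_erase_of_mem ha]; simp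
      _ = _ := by simp [mul_add]
  have h1 : (n : ℝ) * (N + 1) ^ 2 ≤ ((N : ℝ) + 1) * (n ^ 2 + N * M ^ 2) :=
    hR.trans (hid ▸ hL)
  have hn' : (2 : ℝ) ≤ n := by exact_mod_cast hn
  have h2 : (n : ℝ) * (N + 1) ≤ (n ^ 2 + N * M ^ 2) := by
    have hp : (0 : ℝ) < N + 1 := by positivity
    refine le_of_mul_le_mul_left ?_ hp
    linarith [h1]
  have hNpos : (0 : ℝ) < N := by rw [hNR]; nlinarith
  refine le_of_mul_le_mul_left ?_ hNpos
  rw [hNR] at h2 ⊢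
  nlinarith

lemma aux_indep {F E : Type*} [Field F] [Field E] [Algebra F E] (α : E)
    (hα : (minpoly F α).natDegree = 3) (x y w : F)
    (h : algebraMap F E x + algebraMap F E y * α + algebraMap F E w * α ^ 2 = 0) :
    x = 0 ∧ y = 0 ∧ w = 0 := by
  classical
  set P : Polynomial F := Polynomial.C w * Polynomial.X ^ 2 + Polynomial.C y * Polynomial.X
    + Polynomial.C x with hP
  have h0 : P = 0 := by
    by_contra hne
    have h1 : Polynomial.aeval α P = 0 := by
      simp only [hP, map_add, map_mul, Polynomial.aeval_C, Polynomial.aeval_X, map_pow]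
      linear_combination h
    have h2 := Polynomial.natDegree_le_natDegree (minpoly.degree_le_of_ne_zero F α hne h1)
    have h3 : P.natDegree ≤ 2 := Polynomial.natDegree_quadratic_le
    omega
  have c0 := congrArg (fun p => Polynomial.coeff p 0) h0
  have c1 := congrArg (fun p => Polynomial.coeff p 1) h0
  have c2 := congrArg (fun p => Polynomial.coeff p 2) h0
  simp [hP, Polynomial.coeff_X, Polynomial.coeff_C] at c0 c1 c2
  exact ⟨c0, c1, c2⟩

/-- projective line representatives -/
noncomputable def auxD {F E : Type*} [Field F] [Field E] [Algebra F E] (α : E) :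
    Option F → E
  | none => 1
  | some a => α + algebraMap F E a

lemma auxD_form {F E : Type*} [Field F] [Field E] [Algebra F E] (α : E) (i : Option F) :
    ∃ x y : F, auxD α i = algebraMap F E x + algebraMap F E y * α := by
  rcases i with _ | a
  · exact ⟨1, 0, by simp [auxD]⟩
  · exact ⟨a, 1, by simp [auxD, add_comm]⟩

lemma auxD_prop {F E : Type*} [Field F] [Field E] [Algebra F E] (α : E)
    (hα : (minpoly F α).natDegree = 3)
    (c : F) (i j : Option F) (h : auxD α i = algebraMap F E c * auxD α j) :
    i = j := by
  rcases i with _ | a <;> rcases j with _ | b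
  · rfl
  · have := aux_indep α hα (1 - c * b) (-c) 0 (by
      simp only [auxD] at h; simp only [map_sub, map_mul, map_neg, map_one, map_zero]
      linear_combination h)
    have hc : c = 0 := by simpa using this.2.1
    simp [hc] at this
  · have := aux_indep α hα (a - c) 1 0 (by
      simp only [auxD] at h; simp only [map_sub, map_one, map_zero]
      linear_combination h)
    simp_all
  · have := aux_indep α hα (a - c * b) (1 - c) 0 (by
      simp only [auxD] at h; simp only [map_sub, map_mul, map_one, map_zero]
      linear_combination h)
    obtain ⟨h1, h2, -⟩ := this
    have : c = 1 := by linear_combination -h2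
    subst this
    congr 1; linear_combination h1

lemma auxD_ne_zero {F E : Type*} [Field F] [Field E] [Algebra F E] (α : E)
    (hα : (minpoly F α).natDegree = 3)
    (i : Option F) : auxD α i ≠ 0 := by
  intro h0
  rcases i with _ | a
  · simp [auxD] at h0
  · have := aux_indep α hα a 1 0 (by
      simp only [auxD] at h0; simp only [map_one, map_zero]; linear_combination h0)
    simp_all

/-- If `g` maps two distinct projective points of the line into the plane, then `g ∈ F`. -/
lemma auxD_stable {F E : Type*} [Field F] [Field E] [Algebra F E] (α : E)
    (hα : (minpoly F α).natDegree = 3)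
    (g : E) (j l : Option F) (hjl : j ≠ l)
    (hj : ∃ x y : F, g * auxD α j = algebraMap F E x + algebraMap F E y * α)
    (hl : ∃ x y : F, g * auxD α l = algebraMap F E x + algebraMap F E y * α) :
    ∃ c : F, g = algebraMap F E c := by
  have main : ∀ x y u v : F, g = algebraMap F E x + algebraMap F E y * α →
      g * α = algebraMap F E u + algebraMap F E v * α → ∃ c : F, g = algebraMap F E c := by
    intro x y u v h1 h2
    have := aux_indep α hα (-u) (x - v) y (by
      simp only [map_sub, map_neg]; linear_combination h2 - α * h1)
    refine ⟨x, ?_⟩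
    rw [h1, this.2.2]; simp
  obtain ⟨x, y, hj⟩ := hj
  obtain ⟨u, v, hl⟩ := hl
  rcases j with _ | a <;> rcases l with _ | b
  · exact absurd rfl hjl
  · simp only [auxD] at hj hl
    refine main x y (u - b * x) (v - b * y) (by linear_combination hj) ?_
    simp only [map_sub, map_mul]
    linear_combination hl - algebraMap F E b * hj
  · simp only [auxD] at hj hl
    refine main u v (x - a * u) (y - a * v) (by linear_combination hl) ?_
    simp only [map_sub, map_mul]
    linear_combination hj - algebraMap F E a * hl
  · simp only [auxD] at hj hl
    have hab : a - b ≠ 0 := by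
      intro h; apply hjl; congr 1; linear_combination h
    have hab' : algebraMap F E (a - b) ≠ 0 := (map_ne_zero _).2 hab
    have hg : g = algebraMap F E ((x - u) / (a - b)) + algebraMap F E ((y - v) / (a - b)) * α := by
      simp only [map_div₀]
      field_simp
      simp only [map_sub]
      linear_combination hj - hl
    refine main _ _ (x - a * ((x - u) / (a - b))) (y - a * ((y - v) / (a - b))) hg ?_
    rw [map_sub, map_sub, map_mul, map_mul]
    linear_combination hj - algebraMap F E a * hg

lemma auxD_sidon {F E : Type*} [Field F] [Field E] [Algebra F E] (α : E)
    (hα : (minpoly F α).natDegree = 3)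
    (c : F) (hc : c ≠ 0) (i j k l : Option F) (hij : i ≠ j)
    (h : auxD α i * auxD α l = algebraMap F E c * (auxD α k * auxD α j)) :
    i = k ∧ j = l := by
  have hc' : algebraMap F E c ≠ 0 := by simpa using hc
  have nj := auxD_ne_zero α hα j
  by_cases hjl : j = l
  · subst hjl
    refine ⟨auxD_prop α hα c i k ?_, rfl⟩
    apply mul_right_cancel₀ nj
    linear_combination h
  · exfalso
    obtain ⟨e, he⟩ := auxD_stable α hα (auxD α i / auxD α j) j l hjl (by
      obtain ⟨x, y, hxy⟩ := auxD_form α i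
      exact ⟨x, y, by rw [← hxy]; field_simp⟩) (by
      obtain ⟨x, y, hxy⟩ := auxD_form α k
      refine ⟨c * x, c * y, ?_⟩
      rw [div_mul_eq_mul_div, h, map_mul, map_mul]
      field_simp
      rw [hxy])
    refine hij (auxD_prop α hα e i j ?_)
    rw [← he]; field_simp
lemma aux_singer (q : ℕ) (h : IsPrimePow q) :
    ∃ a : Fin (q + 1) → ZMod (q ^ 2 + q + 1), ∀ i j k l, i ≠ j →
      a i - a j = a k - a l → i = k ∧ j = l := by
  obtain ⟨p, m, hp, hm, rfl⟩ := (isPrimePow_nat_iff q).1 h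
  have : Fact p.Prime := ⟨hp⟩
  let F := GaloisField p m
  let E := FiniteField.Extension F p 3
  have hF : Nat.card F = p ^ m := GaloisField.card p m hm.ne'
  have hE : Nat.card E = Nat.card F ^ 3 := FiniteField.natCard_extension F p 3
  have hEF : Module.finrank F E = 3 := FiniteField.finrank_extension F p 3
  have : Finite F := inferInstance
  obtain ⟨α, hα⟩ := Field.exists_primitive_element F E
  rw [Field.primitive_element_iff_minpoly_natDegree_eq, hEF] at hα
  set q := p ^ m with hq
  have hq1 : 1 < q := h.one_lt
  let H : Subgroup Eˣ := (Units.map (algebraMap F E).toMonoidHom).range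
  have hinj : Function.Injective (Units.map (algebraMap F E).toMonoidHom) :=
    Units.map_injective (algebraMap F E).injective
  have hHc : Nat.card H = q - 1 := by
    rw [← hF, ← Nat.card_units]
    exact (Nat.card_congr (MonoidHom.ofInjective hinj).toEquiv).symm
  have hG : Nat.card (Eˣ ⧸ H) = q ^ 2 + q + 1 := by
    have := Subgroup.card_eq_card_quotient_mul_card_subgroup H
    rw [Nat.card_units, hE, hF, hHc] at this
    obtain ⟨r, hr⟩ : ∃ r, q = r + 2 := ⟨q - 2, by omega⟩
    rw [hr] at this ⊢
    have h3 : (r + 2) ^ 3 - 1 = ((r + 2) ^ 2 + (r + 2) + 1) * (r + 2 - 1) := by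
      have : r + 2 - 1 = r + 1 := by omega
      rw [this]
      apply Nat.sub_eq_of_eq_add
      ring
    rw [h3] at this
    exact (Nat.eq_of_mul_eq_mul_right (by omega) this).symm
  have : IsCyclic (Eˣ ⧸ H) := isCyclic_of_surjective (QuotientGroup.mk' H)
    (QuotientGroup.mk'_surjective H)
  let e : Multiplicative (ZMod (q ^ 2 + q + 1)) ≃* (Eˣ ⧸ H) := hG ▸ zmodCyclicMulEquiv inferInstance
  have hcO : Nat.card (Option F) = q + 1 := by rw [Finite.card_option, hF]
  let f : Fin (q + 1) ≃ Option F := (Finite.equivFinOfCardEq hcO).symm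
  let d : Option F → Eˣ := fun i => Units.mk0 (auxD α i) (auxD_ne_zero α hα i)
  refine ⟨fun i => Multiplicative.toAdd (e.symm (QuotientGroup.mk (d (f i)))), ?_⟩
  intro i j k l hij heq
  have h1 : e.symm (QuotientGroup.mk (d (f i)) / QuotientGroup.mk (d (f j))) =
      e.symm (QuotientGroup.mk (d (f k)) / QuotientGroup.mk (d (f l))) := by
    rw [map_div, map_div]
    exact heq
  have h2 := e.symm.injective h1
  rw [← QuotientGroup.mk_div, ← QuotientGroup.mk_div] at h2
  have h3 := QuotientGroup.eq.1 h2.symm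
  obtain ⟨c, hc⟩ := h3
  have h4 : auxD α (f i) * auxD α (f l) =
      algebraMap F E c * (auxD α (f k) * auxD α (f j)) := by
    have := congrArg (Units.val) (eq_inv_mul_iff_mul_eq.1 hc)
    simp only [d, Units.val_mul, Units.val_div_eq_div_val, Units.val_mk0, Units.coe_map] at this
    have nj := auxD_ne_zero α hα (f j)
    have nl := auxD_ne_zero α hα (f l)
    rw [div_mul_eq_mul_div, div_eq_div_iff nl nj] at this
    rw [← this]
    simp only [RingHom.toMonoidHom_eq_coe, MonoidHom.coe_coe]
    ring
  obtain ⟨h5, h6⟩ := auxD_sidon α hα c c.ne_zero _ _ _ _ (f.injective.ne hij) h4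
  exact ⟨f.injective h5, f.injective h6⟩

open ComplexConjugate in
lemma aux_upper (q : ℕ) (h : IsPrimePow q) :
    ∃ z : Fin (q + 1) → ℂ, (∀ k, ‖z k‖ = 1) ∧ ∀ ν ∈ Finset.Icc 1 (q ^ 2 + q),
      ‖∑ k, z k ^ ν‖ = Real.sqrt q := by
  have hex := aux_singer q h
  have : NeZero (q ^ 2 + q + 1) := ⟨by omega⟩
  set v := q ^ 2 + q + 1 with hv
  obtain ⟨a, ha⟩ := hex
  let ψ : AddChar (ZMod v) ℂ := ZMod.stdAddChar
  have hψ : ψ.IsPrimitive := ZMod.isPrimitive_stdAddChar v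
  refine ⟨fun k => ψ (a k), fun k => AddChar.norm_apply _ _, ?_⟩
  intro ν hν
  rw [Finset.mem_Icc] at hν
  have hν0 : (ν : ZMod v) ≠ 0 := by
    rw [Ne, ZMod.natCast_eq_zero_iff]
    intro hd
    have := Nat.le_of_dvd (by omega) hd
    omega
  have himg : Finset.image (fun x : Fin (q + 1) × Fin (q + 1) => a x.1 - a x.2)
      (Finset.univ.offDiag) = Finset.univ.erase 0 := by
    apply Finset.eq_of_subset_of_card_le
    · intro y hy
      obtain ⟨⟨i, j⟩, hx, rfl⟩ := Finset.mem_image.1 hy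
      rw [Finset.mem_offDiag] at hx
      simp only [Finset.mem_erase, Finset.mem_univ, and_true]
      intro h0
      exact hx.2.2 (ha i j j i hx.2.2 (by
        have : a i = a j := sub_eq_zero.1 h0
        simp only [this])).1
    · rw [Finset.card_image_of_injOn, Finset.offDiag_card,
        Finset.card_erase_of_mem (Finset.mem_univ _), Finset.card_univ, ZMod.card]
      · simp only [Finset.card_univ, Fintype.card_fin, hv]
        have : (q + 1) * (q + 1) = q ^ 2 + q + (q + 1) := by ring
        omega
      · rintro ⟨i, j⟩ hx ⟨k, l⟩ hy hxy
        simp only [Finset.coe_offDiag, Set.mem_offDiag] at hx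
        obtain ⟨h1, h2⟩ := ha i j k l hx.2.2 hxy
        rw [h1, h2]
  have hinj : Set.InjOn (fun x : Fin (q + 1) × Fin (q + 1) => a x.1 - a x.2)
      (Finset.univ.offDiag : Finset (Fin (q + 1) × Fin (q + 1))) := by
    rintro ⟨i, j⟩ hx ⟨k, l⟩ hy hxy
    simp only [Finset.coe_offDiag, Set.mem_offDiag] at hx
    obtain ⟨h1, h2⟩ := ha i j k l hx.2.2 hxy
    rw [h1, h2]
  have hsum : ∑ y ∈ Finset.univ.erase (0 : ZMod v), ψ (y * ν) = -1 := by
    have h1 := AddChar.sum_mulShift (ν : ZMod v) hψ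
    rw [if_neg hν0, ← Finset.add_sum_erase _ _ (Finset.mem_univ (0 : ZMod v))] at h1
    simp only [zero_mul, AddChar.map_zero_eq_one] at h1
    push_cast at h1
    linear_combination h1
  have hsq : ((‖∑ k, ψ (a k) ^ ν‖ ^ 2 : ℝ) : ℂ) = q := by
    rw [← Complex.normSq_eq_norm_sq, ← Complex.mul_conj, map_sum, Finset.sum_mul_sum,
      ← Finset.sum_product', ← Finset.diag_union_offDiag,
      Finset.sum_union (Finset.disjoint_diag_offDiag _)]
    have hterm : ∀ i j, ψ (a i) ^ ν * conj (ψ (a j) ^ ν) = ψ ((a i - a j) * ν) := by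
      intro i j
      rw [map_pow, ← AddChar.map_neg_eq_conj, ← mul_pow, ← AddChar.map_add_eq_mul,
        ← AddChar.map_nsmul_eq_pow, nsmul_eq_mul]
      congr 1; ring
    simp only [hterm]
    rw [← Finset.sum_image (f := fun y => ψ (y * ν)) hinj, himg, hsum, Finset.sum_diag]
    simp
  have hsq' : ‖∑ k, ψ (a k) ^ ν‖ ^ 2 = (q : ℝ) := by exact_mod_cast hsq
  rw [← hsq', Real.sqrt_sq (norm_nonneg _)]

theorem inf_max_eq_sqrt_sub_one (n : ℕ) (h : IsPrimePow (n - 1)) :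
    sInf {M : ℝ | ∃ z : Fin n → ℂ, (∀ k, ‖z k‖ = 1) ∧
        M = sSup {y : ℝ | ∃ ν ∈ Finset.Icc 1 (n ^ 2 - n), y = ‖∑ k, z k ^ ν‖}} =
      Real.sqrt ((n : ℝ) - 1) := by
  obtain ⟨q, rfl⟩ : ∃ q, n = q + 1 := ⟨n - 1, by have := h.one_lt; omega⟩
  simp only [Nat.add_sub_cancel] at h
  have hq := h.one_lt
  have hN : (q + 1) ^ 2 - (q + 1) = q ^ 2 + q := by
    apply Nat.sub_eq_of_eq_add; ring
  apply IsLeast.csInf_eq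
  constructor
  · obtain ⟨z, hz, hs⟩ := aux_upper q h
    refine ⟨z, hz, ?_⟩
    have : {y : ℝ | ∃ ν ∈ Finset.Icc 1 ((q + 1) ^ 2 - (q + 1)), y = ‖∑ k, z k ^ ν‖} =
        {Real.sqrt q} := by
      rw [hN]
      ext y
      simp only [Set.mem_ofPred_eq, Set.mem_singleton_iff]
      constructor
      · rintro ⟨ν, hν, rfl⟩
        exact hs ν hν
      · rintro rfl
        have h1 : 1 ∈ Finset.Icc 1 (q ^ 2 + q) := Finset.mem_Icc.2 ⟨le_rfl, by nlinarith⟩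
        exact ⟨1, h1, (hs 1 h1).symm⟩
    rw [this, csSup_singleton]
    simp
  · rintro M ⟨z, hz, rfl⟩
    have hfin : {y : ℝ | ∃ ν ∈ Finset.Icc 1 ((q + 1) ^ 2 - (q + 1)),
        y = ‖∑ k, z k ^ ν‖}.Finite := by
      refine ((Finset.Icc 1 ((q + 1) ^ 2 - (q + 1))).finite_toSet.image
        (fun ν => ‖∑ k, z k ^ ν‖)).subset ?_
      rintro y ⟨ν, hν, rfl⟩
      exact ⟨ν, hν, rfl⟩
    have hle : ∀ ν ∈ Finset.Icc 1 ((q + 1) ^ 2 - (q + 1)), ‖∑ k, z k ^ ν‖ ≤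
        sSup {y : ℝ | ∃ ν ∈ Finset.Icc 1 ((q + 1) ^ 2 - (q + 1)), y = ‖∑ k, z k ^ ν‖} :=
      fun ν hν => le_csSup hfin.bddAbove ⟨ν, hν, rfl⟩
    refine Real.sqrt_le_iff.2 ⟨?_, aux_lower (by omega) z hz _ hle⟩
    exact (norm_nonneg _).trans (hle 1 (Finset.mem_Icc.2 ⟨le_rfl, by rw [hN]; nlinarith⟩))
end

section
/- Let n ≥ 3 be a prime power and 2 ≤ i ≤ n−1. Then the infimum over n-tuples (z_1,...,z_n) with |z_k| ≥ 1 of max_{ν=1,...,n²−i} |∑_{k=1}^n z_k^ν| equals √n. -/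
open Finset in
theorem newton_neg_false {σ : Type*} [Fintype σ] [DecidableEq σ] (w : σ → ℂ) (P : ℕ → ℝ)
    (hP : ∀ ν, 1 ≤ ν → ν ≤ Fintype.card σ + 1 → P ν < 0 ∧ ∑ s, w s ^ ν = (P ν : ℂ)) : False := by
  set e : ℕ → ℂ := fun k => MvPolynomial.aeval w (MvPolynomial.esymm σ ℂ k) with he
  have newton : ∀ k : ℕ, (k : ℂ) * e k = (-1) ^ (k + 1) *
      ∑ a ∈ antidiagonal k with a.1 < k, (-1) ^ a.1 * e a.1 * ∑ s, w s ^ a.2 := by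
    intro k
    have := congrArg (MvPolynomial.aeval w) (MvPolynomial.mul_esymm_eq_sum σ ℂ k)
    simpa [he, map_sum, MvPolynomial.psum] using this
  have key : ∀ k, k ≤ Fintype.card σ + 1 → ∃ r : ℝ, 0 < r ∧ (-1) ^ k * e k = (r : ℂ) := by
    intro k
    induction k using Nat.strong_induction_on with
    | _ k ih =>
      intro hk
      rcases Nat.eq_zero_or_pos k with rfl | hk0
      · exact ⟨1, one_pos, by simp [he, MvPolynomial.esymm_zero]⟩
      · have h1 : ∀ a : ℕ, ∃ r : ℝ, a < k → 0 < r ∧ (-1) ^ a * e a = (r : ℂ) := by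
          intro a
          by_cases ha : a < k
          · obtain ⟨r, hr⟩ := ih a ha (by omega)
            exact ⟨r, fun _ => hr⟩
          · exact ⟨0, fun h => absurd h ha⟩
        choose C hC using h1
        have hkc : (k : ℂ) ≠ 0 := by exact_mod_cast hk0.ne'
        refine ⟨(∑ a ∈ antidiagonal k with a.1 < k, C a.1 * (-P a.2)) / k, ?_, ?_⟩
        · apply div_pos _ (by exact_mod_cast hk0)
          apply sum_pos
          · intro a ha
            simp only [mem_filter, HasAntidiagonal.mem_antidiagonal] at ha
            exact mul_pos (hC _ ha.2).1 (by have := (hP a.2 (by omega) (by omega)).1; linarith)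
          · exact ⟨(0, k), by simp [hk0]⟩
        · have h2 : ∑ a ∈ antidiagonal k with a.1 < k, (-1) ^ a.1 * e a.1 * ∑ s, w s ^ a.2
              = ∑ a ∈ antidiagonal k with a.1 < k, (C a.1 : ℂ) * (P a.2 : ℂ) := by
            apply sum_congr rfl
            intro a ha
            simp only [mem_filter, HasAntidiagonal.mem_antidiagonal] at ha
            rw [(hC _ ha.2).2, (hP a.2 (by omega) (by omega)).2]
          have h3 := newton k
          rw [h2] at h3
          push_cast
          rw [eq_div_iff hkc]
          have h4 : ((-1 : ℂ) ^ k) * (-1) ^ k = 1 := by rw [← mul_pow]; simp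
          calc (-1) ^ k * e k * k = (-1) ^ k * (k * e k) := by ring
            _ = -(((-1 : ℂ) ^ k) * (-1) ^ k) *
                ∑ a ∈ antidiagonal k with a.1 < k, (C a.1 : ℂ) * (P a.2 : ℂ) := by
                rw [h3]; ring
            _ = _ := by rw [h4]; simp [sum_neg_distrib]
  obtain ⟨r, hr, h⟩ := key (Fintype.card σ + 1) le_rfl
  have : e (Fintype.card σ + 1) = 0 := by
    simp only [he, MvPolynomial.esymm]
    rw [powersetCard_eq_empty.2 (by simp)]
    simp
  rw [this, mul_zero] at h
  have : r = 0 := by exact_mod_cast h.symm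
  exact hr.ne' this

theorem cassels_lower (n : ℕ) (z : Fin n → ℂ) (hz : ∀ k, 1 ≤ ‖z k‖) :
    ∃ ν, 1 ≤ ν ∧ ν ≤ n ^ 2 - n + 1 ∧ Real.sqrt n ≤ ‖∑ k, z k ^ ν‖ := by
  by_contra! hcon
  have hcard : Fintype.card {x : Fin n × Fin n // x.1 ≠ x.2} = n ^ 2 - n := by
    have : (Finset.univ : Finset (Fin n)).offDiag.card = n ^ 2 - n := by
      rw [Finset.offDiag_card]; simp [sq]
    rw [← this]
    apply Fintype.card_of_subtype
    simp
  refine newton_neg_false (σ := {x : Fin n × Fin n // x.1 ≠ x.2})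
    (fun s => z s.1.1 * (starRingEnd ℂ) (z s.1.2))
    (fun ν => ‖∑ k, z k ^ ν‖ ^ 2 - ∑ k, (‖z k‖ ^ ν) ^ 2) ?_
  intro ν h1 h2
  rw [hcard] at h2
  constructor
  · have h3 := hcon ν h1 h2
    have h4 : ‖∑ k, z k ^ ν‖ ^ 2 < n := by
      rw [← Real.sq_sqrt (Nat.cast_nonneg n)]
      exact pow_lt_pow_left₀ h3 (norm_nonneg _) two_ne_zero
    have h5 : (n : ℝ) ≤ ∑ k, (‖z k‖ ^ ν) ^ 2 := by
      calc (n : ℝ) = ∑ k : Fin n, 1 := by simp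
        _ ≤ _ := Finset.sum_le_sum fun k _ => one_le_pow₀ (one_le_pow₀ (hz k))
    linarith
  · have h6 : ((‖∑ k, z k ^ ν‖ : ℂ)) ^ 2 =
        ∑ x : Fin n × Fin n, (z x.1 * (starRingEnd ℂ) (z x.2)) ^ ν := by
      rw [← Complex.mul_conj', map_sum, Finset.sum_mul_sum, Fintype.sum_prod_type]
      simp [mul_pow]
    have h7 : ∑ x : Fin n × Fin n, (z x.1 * (starRingEnd ℂ) (z x.2)) ^ ν
        = ∑ s : {x : Fin n × Fin n // x.1 ≠ x.2},
            (z s.1.1 * (starRingEnd ℂ) (z s.1.2)) ^ ν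
          + ∑ k, ((‖z k‖ : ℂ) ^ ν) ^ 2 := by
      rw [← Finset.sum_filter_add_sum_filter_not Finset.univ
        (fun x : Fin n × Fin n => x.1 ≠ x.2)]
      congr 1
      · exact (Finset.sum_subtype _ (by simp) _)
      · symm
        apply Finset.sum_bij (fun k _ => (k, k))
        · simp
        · simp
        · rintro ⟨a, b⟩ h
          simp at h
          subst h
          simp
        · intro k _
          simp only
          rw [Complex.mul_conj', ← pow_mul, ← pow_mul, mul_comm]
    push_cast
    rw [h6, h7]
    ring

theorem char_sum_bound {F K : Type} [Field F] [Field K] [Fintype F] [Fintype K] [DecidableEq F]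
    [DecidableEq K] [Algebra F K] (hc : Fintype.card K = Fintype.card F ^ 2) (θ : K)
    (hθ : ∀ x : F, algebraMap F K x ≠ θ) (ψ : MulChar K ℂ) (hψ : ψ ≠ 1) :
    ‖∑ a : F, ψ (θ + algebraMap F K a)‖ ^ 2 ≤ Fintype.card F := by
  set ι := algebraMap F K with hι
  have inj : Function.Injective ι := (algebraMap F K).injective
  have hne : ∀ a : F, θ + ι a ≠ 0 := by
    intro a h
    apply hθ (-a)
    rw [map_neg]
    exact (eq_neg_of_add_eq_zero_left h).symm
  let f : F × F → K := fun x => (θ + ι x.1) / (θ + ι x.2)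
  have h1 : ((‖∑ a : F, ψ (θ + ι a)‖ : ℂ)) ^ 2 = ∑ x : F × F, ψ (f x) := by
    rw [← Complex.mul_conj', map_sum, Finset.sum_mul_sum, Fintype.sum_prod_type]
    refine Finset.sum_congr rfl fun a _ => Finset.sum_congr rfl fun b _ => ?_
    have := MulChar.star_apply' ψ (θ + ι b)
    rw [RCLike.star_def] at this
    rw [this, MulChar.inv_apply', ← map_mul, ← div_eq_mul_inv]
  have h2 : ∑ x : F × F, ψ (f x) = ∑ x ∈ (Finset.univ : Finset F).offDiag, ψ (f x)
      + Fintype.card F := by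
    rw [← Finset.univ_product_univ, ← Finset.diag_union_offDiag,
      Finset.sum_union (Finset.disjoint_diag_offDiag _), add_comm]
    congr 1
    rw [Finset.sum_diag]
    simp [f, div_self (hne _)]
  have finj : Set.InjOn f ((Finset.univ : Finset F).offDiag : Set (F × F)) := by
    rintro ⟨a, b⟩ hab ⟨c, d⟩ hcd h
    simp at hab hcd
    simp only [f] at h
    rw [div_eq_div_iff (hne _) (hne _)] at h
    have h' : (ι (a + d - b - c)) * θ = ι (c * b - a * d) := by
      simp only [map_add, map_sub, map_mul]
      linear_combination h
    have h0 : a + d - b - c = 0 := by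
      by_contra h0
      apply hθ ((c * b - a * d) / (a + d - b - c))
      change ι _ = θ
      rw [map_div₀, ← h', mul_div_cancel_left₀]
      rwa [Ne, map_eq_zero]
    have h3 : c * b - a * d = 0 := by
      apply inj; rw [← h', h0]; simp
    have h4 : (a - b) * (b - d) = 0 := by
      linear_combination h3 + b * h0
    rcases mul_eq_zero.1 h4 with h5 | h5
    · exact absurd (sub_eq_zero.1 h5) hab
    · have : b = d := sub_eq_zero.1 h5
      subst this
      have : a = c := by linear_combination h0
      subst this
      rfl
  have himg : Finset.image f (Finset.univ : Finset F).offDiag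
      = Finset.univ \ Finset.image ι Finset.univ := by
    apply Finset.eq_of_subset_of_card_le
    · intro u hu
      simp only [Finset.mem_image, Finset.mem_offDiag, Finset.mem_univ, true_and] at hu
      obtain ⟨⟨a, b⟩, hab, rfl⟩ := hu
      simp only [Finset.mem_sdiff, Finset.mem_univ, Finset.mem_image, true_and, not_exists]
      intro x hx
      simp only [f] at hx
      rw [eq_div_iff (hne _)] at hx
      have h' : ι (x - 1) * θ = ι (a - x * b) := by
        simp only [map_sub, map_mul, map_one]
        linear_combination hx
      by_cases h0 : x - 1 = 0
      · have : x = 1 := sub_eq_zero.1 h0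
        subst this
        rw [h0, map_zero, zero_mul] at h'
        have := (map_eq_zero ι).1 h'.symm
        apply hab
        linear_combination this
      · apply hθ ((a - x * b) / (x - 1))
        change ι _ = θ
        rw [map_div₀, ← h', mul_div_cancel_left₀]
        rwa [Ne, map_eq_zero]
    · rw [Finset.card_image_of_injOn finj, Finset.offDiag_card, Finset.card_univ_sdiff,
        Finset.card_image_of_injective _ inj, hc]
      simp [sq]
  have h3 : ∑ x ∈ (Finset.univ : Finset F).offDiag, ψ (f x) = - ∑ x : F, ψ (ι x) := by
    rw [← Finset.sum_image (f := fun u => ψ u) finj, himg]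
    have := Finset.sum_sdiff (f := fun u => ψ u)
      (Finset.subset_univ (Finset.image ι Finset.univ))
    rw [MulChar.sum_eq_zero_of_ne_one hψ, Finset.sum_image (fun _ _ _ _ h => inj h)] at this
    exact eq_neg_of_add_eq_zero_left this
  let φ : MulChar F ℂ :=
    { toMonoidHom := (ψ.toMonoidHom).comp (ι : F →* K)
      map_nonunit' := by
        intro a ha
        have : a = 0 := by simpa using ha
        subst this
        simpa using ψ.map_nonunit (a := 0) (by simp) }
  have h4 : ∃ r : ℝ, 0 ≤ r ∧ ∑ x : F, ψ (ι x) = (r : ℂ) := by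
    have h5 : ∑ x : F, ψ (ι x) = ∑ x : F, φ x := rfl
    rw [h5]
    by_cases hφ : φ = 1
    · refine ⟨Fintype.card Fˣ, by positivity, ?_⟩
      rw [hφ, MulChar.sum_one_eq_card_units]
      simp
    · exact ⟨0, le_rfl, by rw [MulChar.sum_eq_zero_of_ne_one hφ]; simp⟩
  obtain ⟨r, hr, hr'⟩ := h4
  rw [h2, h3, hr'] at h1
  have : ‖∑ a : F, ψ (θ + ι a)‖ ^ 2 = -r + Fintype.card F := by exact_mod_cast h1
  linarith

theorem bose_upper (n : ℕ) (hp : IsPrimePow n) :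
    ∃ z : Fin n → ℂ, (∀ k, ‖z k‖ = 1) ∧
      ∀ ν, 1 ≤ ν → ν ≤ n ^ 2 - 2 → ‖∑ k, z k ^ ν‖ ≤ Real.sqrt n := by
  classical
  obtain ⟨p, k, hpp, hk, rfl⟩ := hp
  haveI : Fact p.Prime := ⟨hpp.nat_prime⟩
  let F := GaloisField p k
  letI : Fintype F := Fintype.ofFinite F
  let K := FiniteField.Extension F p 2
  letI : Fintype K := Fintype.ofFinite K
  have hF : Fintype.card F = p ^ k := by
    rw [Fintype.card_eq_nat_card]; exact GaloisField.card p k hk.ne'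
  have hK : Fintype.card K = Fintype.card F ^ 2 := by
    rw [Fintype.card_eq_nat_card, Fintype.card_eq_nat_card]
    exact FiniteField.natCard_extension F p 2
  have hF1 : 1 < Fintype.card F := Fintype.one_lt_card
  obtain ⟨θ, hθ⟩ : ∃ θ : K, ∀ x : F, algebraMap F K x ≠ θ := by
    by_contra! h
    have := Fintype.card_le_of_surjective _ h
    rw [hK] at this
    nlinarith
  obtain ⟨χ, hχ⟩ := MulChar.exists_mulChar_orderOf K (dvd_refl (Fintype.card K - 1))
    (Complex.isPrimitiveRoot_exp (Fintype.card K - 1) (by rw [hK]; have : 1 < Fintype.card F ^ 2 := by nlinarith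
                                                          omega))
  let eq : Fin (p ^ k) ≃ F := (Fintype.equivFinOfCardEq hF).symm
  refine ⟨fun j => χ (θ + algebraMap F K (eq j)), ?_, ?_⟩
  · intro j
    have hu : IsUnit (θ + algebraMap F K (eq j)) := by
      rw [isUnit_iff_ne_zero]
      intro h
      apply hθ (-(eq j))
      rw [map_neg]
      exact (eq_neg_of_add_eq_zero_left h).symm
    obtain ⟨u, hu⟩ := hu
    beta_reduce
    rw [← hu]
    exact Complex.norm_eq_one_of_mem_rootsOfUnity (χ.apply_mem_rootsOfUnity u)
  · intro ν h1 h2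
    have hψ : χ ^ ν ≠ 1 := by
      apply pow_ne_one_of_lt_orderOf (by omega)
      rw [hχ, hK, hF]
      rw [hF] at hF1
      have : 1 < (p ^ k) ^ 2 := by nlinarith
      omega
    have h := char_sum_bound hK θ hθ (χ ^ ν) hψ
    rw [hF] at h
    apply Real.le_sqrt_of_sq_le
    convert h using 3
    rw [← Equiv.sum_comp eq]
    refine Finset.sum_congr rfl fun j _ => ?_
    rw [MulChar.pow_apply' _ (by omega)]

theorem inf_max_eq_sqrt (n i : ℕ) (hn : 3 ≤ n) (hp : IsPrimePow n)
    (hi1 : 2 ≤ i) (hi2 : i ≤ n - 1) :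
    sInf {M : ℝ | ∃ z : Fin n → ℂ, (∀ k, 1 ≤ ‖z k‖) ∧
        M = sSup {y : ℝ | ∃ ν ∈ Finset.Icc 1 (n ^ 2 - i), y = ‖∑ k, z k ^ ν‖}} =
      Real.sqrt n := by
  have hsq : 3 * n ≤ n ^ 2 := by nlinarith
  have lower : ∀ M ∈ {M : ℝ | ∃ z : Fin n → ℂ, (∀ k, 1 ≤ ‖z k‖) ∧
        M = sSup {y : ℝ | ∃ ν ∈ Finset.Icc 1 (n ^ 2 - i), y = ‖∑ k, z k ^ ν‖}},
        Real.sqrt n ≤ M := by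
    rintro M ⟨z, hz, rfl⟩
    obtain ⟨ν, h1, h2, h3⟩ := cassels_lower n z hz
    refine h3.trans (le_csSup ?_ ⟨ν, Finset.mem_Icc.2 ⟨h1, by omega⟩, rfl⟩)
    have : {y : ℝ | ∃ ν ∈ Finset.Icc 1 (n ^ 2 - i), y = ‖∑ k, z k ^ ν‖}
        = (fun ν : ℕ => ‖∑ k, z k ^ ν‖) '' (Finset.Icc 1 (n ^ 2 - i) : Finset ℕ) := by
      ext y
      simp [eq_comm]
    rw [this]
    exact ((Finset.finite_toSet _).image _).bddAbove
  obtain ⟨z, hz1, hz2⟩ := bose_upper n hp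
  apply le_antisymm
  · refine csInf_le_of_le ⟨_, lower⟩ ⟨z, fun k => (hz1 k).ge, rfl⟩ ?_
    apply csSup_le
    · exact ⟨_, 1, Finset.mem_Icc.2 ⟨le_rfl, by omega⟩, rfl⟩
    · rintro y ⟨ν, hν, rfl⟩
      rw [Finset.mem_Icc] at hν
      exact hz2 ν hν.1 (by omega)
  · exact le_csInf ⟨_, z, fun k => (hz1 k).ge, rfl⟩ lower
end

section
/- If n+1 is prime, then √n ≤ inf over (z_1,...,z_n) with |z_k| ≥ 1 of max_{ν=1,...,n²} |∑_{k=1}^n z_k^ν| ≤ √(n+1). -/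
/-- Cassels-type lemma: real power sums of `w` cannot all be negative in a range longer than
the number of terms. -/
lemma cassels_aux {σ : Type*} [Fintype σ] (w : σ → ℂ) (s : ℕ → ℝ) (K : ℕ)
    (hK : Fintype.card σ < K) (hs : ∀ ν, 1 ≤ ν → ν ≤ K → ∑ i, w i ^ ν = (s ν : ℂ)) :
    ∃ ν, 1 ≤ ν ∧ ν ≤ K ∧ 0 ≤ s ν := by
  classical
  by_contra! hneg
  set e : ℕ → ℂ := fun k => MvPolynomial.aeval w (MvPolynomial.esymm σ ℂ k) with he
  have newton : ∀ k : ℕ, (k : ℂ) * e k = (-1) ^ (k + 1) *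
      ∑ a ∈ Finset.HasAntidiagonal.antidiagonal k with a.1 < k, (-1) ^ a.1 * e a.1 * ∑ i, w i ^ a.2 := by
    intro k
    have := congrArg (MvPolynomial.aeval w) (MvPolynomial.mul_esymm_eq_sum σ ℂ k)
    simpa [MvPolynomial.psum, he, map_sum] using this
  have pos : ∀ k, k ≤ K → ∃ r : ℝ, 0 < r ∧ (-1) ^ k * e k = (r : ℂ) := by
    intro k
    induction k using Nat.strong_induction_on with
    | _ k ih =>
      intro hk
      rcases Nat.eq_zero_or_pos k with rfl | hk0
      · exact ⟨1, one_pos, by simp [he]⟩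
      have key : ∀ j, ∃ r : ℝ, j < k → 0 < r ∧ (-1) ^ j * e j = (r : ℂ) := by
        intro j
        by_cases hj : j < k
        · obtain ⟨r, hr⟩ := ih j hj (by omega)
          exact ⟨r, fun _ => hr⟩
        · exact ⟨0, fun h => absurd h hj⟩
      choose r hr using key
      refine ⟨(∑ a ∈ Finset.HasAntidiagonal.antidiagonal k with a.1 < k, r a.1 * (- s a.2)) / k, ?_, ?_⟩
      · apply div_pos _ (by exact_mod_cast hk0)
        apply Finset.sum_pos
        · intro a ha
          simp only [Finset.mem_filter, Finset.HasAntidiagonal.mem_antidiagonal] at ha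
          exact mul_pos (hr _ ha.2).1 (neg_pos.2 (hneg _ (by omega) (by omega)))
        · exact ⟨(0, k), by simp [hk0]⟩
      · have hkc : (k : ℂ) ≠ 0 := by exact_mod_cast hk0.ne'
        have h1 : ∑ a ∈ Finset.HasAntidiagonal.antidiagonal k with a.1 < k, (-1) ^ a.1 * e a.1 * ∑ i, w i ^ a.2
            = ∑ a ∈ Finset.HasAntidiagonal.antidiagonal k with a.1 < k, (r a.1 : ℂ) * (s a.2 : ℂ) := by
          apply Finset.sum_congr rfl
          intro a ha
          simp only [Finset.mem_filter, Finset.HasAntidiagonal.mem_antidiagonal] at ha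
          rw [(hr _ ha.2).2, hs _ (by omega) (by omega)]
        have h2 := newton k
        rw [h1] at h2
        push_cast
        rw [eq_div_iff hkc]
        have h3 : ((-1 : ℂ) ^ k) * (-1) ^ k = 1 := by rw [← mul_pow]; simp
        calc (-1) ^ k * e k * k = (-1) ^ k * (k * e k) := by ring
          _ = - (((-1 : ℂ) ^ k) * (-1) ^ k) * ∑ a ∈ Finset.HasAntidiagonal.antidiagonal k with a.1 < k,
              (r a.1 : ℂ) * (s a.2 : ℂ) := by rw [h2]; ring
          _ = _ := by rw [h3]; simp
  obtain ⟨r, hr, h⟩ := pos K le_rfl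
  have : e K = 0 := by
    simp only [he, MvPolynomial.esymm]
    rw [Finset.powersetCard_eq_empty.2 (by simpa using hK)]
    simp
  rw [this, mul_zero] at h
  exact hr.ne (by exact_mod_cast h)

lemma lower_aux (n : ℕ) (hn : 1 ≤ n) (z : Fin n → ℂ) (hz : ∀ k, 1 ≤ ‖z k‖) :
    ∃ ν ∈ Finset.Icc 1 (n ^ 2), Real.sqrt n ≤ ‖∑ k, z k ^ ν‖ := by
  have hcard : Fintype.card {p : Fin n × Fin n // ¬ p.1 = p.2} < n ^ 2 := by
    have : Fintype.card (Fin n × Fin n) = n ^ 2 := by simp [sq]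
    rw [← this]
    exact Fintype.card_subtype_lt (x := (⟨0, hn⟩, ⟨0, hn⟩)) (by simp)
  obtain ⟨ν, h1, h2, h3⟩ := cassels_aux
    (fun p : {p : Fin n × Fin n // ¬ p.1 = p.2} => z p.1.1 * (starRingEnd ℂ) (z p.1.2))
    (fun ν => ‖∑ k, z k ^ ν‖ ^ 2 - ∑ k, ‖z k‖ ^ (2 * ν)) (n ^ 2) hcard (by
      intro ν _ _
      have a1 : ((‖∑ k, z k ^ ν‖ : ℂ)) ^ 2
          = ∑ p : Fin n × Fin n, (z p.1 * (starRingEnd ℂ) (z p.2)) ^ ν := by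
        rw [← Complex.mul_conj', map_sum, Finset.sum_mul_sum, ← Finset.univ_product_univ,
          Finset.sum_product]
        simp [mul_pow]
      have a2 : ∑ p : {p : Fin n × Fin n // p.1 = p.2},
          (z p.1.1 * (starRingEnd ℂ) (z p.1.2)) ^ ν = ∑ k, (‖z k‖ : ℂ) ^ (2 * ν) := by
        symm
        refine Fintype.sum_bijective (fun k => ⟨(k, k), rfl⟩) ⟨?_, ?_⟩ _ _ ?_
        · intro a b hab
          simpa using hab
        · rintro ⟨⟨a, b⟩, hab⟩
          exact ⟨a, by simpa using hab⟩
        · intro k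
          simp only
          rw [Complex.mul_conj', pow_mul]
      push_cast
      rw [a1, ← a2, ← Fintype.sum_subtype_add_sum_subtype (fun p : Fin n × Fin n => p.1 = p.2)]
      ring)
  refine ⟨ν, Finset.mem_Icc.2 ⟨h1, h2⟩, ?_⟩
  apply Real.sqrt_le_iff.2 ⟨norm_nonneg _, ?_⟩
  have : (n : ℝ) ≤ ∑ k, ‖z k‖ ^ (2 * ν) := by
    calc (n : ℝ) = ∑ k : Fin n, (1 : ℝ) := by simp
      _ ≤ _ := Finset.sum_le_sum fun k _ => one_le_pow₀ (hz k)
  linarith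

lemma upper_aux (n : ℕ) (h : (n + 1).Prime) :
    ∃ z : Fin n → ℂ, (∀ k, 1 ≤ ‖z k‖) ∧
      ∀ ν ∈ Finset.Icc 1 (n ^ 2), ‖∑ k, z k ^ ν‖ ≤ Real.sqrt ((n : ℝ) + 1) := by
  classical
  haveI : Fact (n + 1).Prime := ⟨h⟩
  have hn : n ≠ 0 := by rintro rfl; exact absurd h (by decide)
  obtain ⟨χ, hχ⟩ := MulChar.exists_mulChar_orderOf (ZMod (n + 1)) (n := n)
    (by simp [ZMod.card]) (Complex.isPrimitiveRoot_exp n hn)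
  have hχn : χ ^ n = 1 := orderOf_dvd_iff_pow_eq_one.1 hχ.dvd
  set ψ : AddChar (ZMod (n + 1)) ℂ := ZMod.stdAddChar with hψ
  have hprim : ψ.IsPrimitive := ZMod.isPrimitive_stdAddChar _
  have hcard : Fintype.card (ZMod (n + 1))ˣ = n := by
    rw [ZMod.card_units_eq_totient, Nat.totient_prime h]; simp
  let E : Fin n ≃ (ZMod (n + 1))ˣ := (Fintype.equivFinOfCardEq hcard).symm
  refine ⟨fun k => χ (E k) * ψ (E k), ?_, ?_⟩
  · intro k
    have h1 : ‖χ (E k : ZMod (n + 1))‖ = 1 := by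
      have : (χ (E k : ZMod (n + 1))) ^ n = 1 := by
        rw [← MulChar.pow_apply_coe, hχn, MulChar.one_apply_coe]
      exact Complex.norm_eq_one_of_pow_eq_one this hn
    rw [norm_mul, h1, AddChar.norm_apply]
    simp
  · intro ν hν
    rw [Finset.mem_Icc] at hν
    have hsum : ∑ k, (χ (E k) * ψ (E k)) ^ ν
        = gaussSum (χ ^ ν) (ψ.mulShift (ν : ZMod (n + 1))) := by
      rw [Equiv.sum_comp E (fun u => (χ (u : ZMod (n + 1)) * ψ u) ^ ν), gaussSum]
      symm
      refine Eq.trans (b := ∑ a ∈ Finset.univ.filter (fun a : ZMod (n + 1) => a ≠ 0),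
        (χ ^ ν) a * ψ.mulShift ν a) ?_ ?_
      · symm
        apply Finset.sum_subset (Finset.filter_subset _ _)
        intro x _ hx
        have : x = 0 := by simpa using hx
        rw [this, MulChar.map_zero, zero_mul]
      · symm
        refine Finset.sum_bij (fun u _ => (u : ZMod (n + 1))) ?_ ?_ ?_ ?_
        · intro u _; simp
        · intro a _ b _ hab; exact Units.ext hab
        · intro b hb
          exact ⟨Units.mk0 b (by simpa using hb), Finset.mem_univ _, rfl⟩
        · intro u _
          rw [mul_pow, MulChar.pow_apply_coe, AddChar.mulShift_apply, ← nsmul_eq_mul,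
            AddChar.map_nsmul_eq_pow]
    rw [hsum]
    have hs1 : (1 : ℝ) ≤ Real.sqrt ((n : ℝ) + 1) := by
      rw [Real.one_le_sqrt]; linarith [Nat.cast_nonneg (α := ℝ) n]
    by_cases h1 : (ν : ZMod (n + 1)) = 0
    · have hne : χ ^ ν ≠ 1 := by
        intro h2
        have d1 : n ∣ ν := hχ ▸ orderOf_dvd_of_pow_eq_one h2
        have d2 : (n + 1) ∣ ν := (ZMod.natCast_eq_zero_iff _ _).1 h1
        have d3 : n * (n + 1) ∣ ν := Nat.Coprime.mul_dvd_of_dvd_of_dvd (by simp) d1 d2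
        have := Nat.le_of_dvd hν.1 d3
        have := hν.2
        have := Nat.pos_of_ne_zero hn
        nlinarith
      rw [h1, AddChar.mulShift_zero, gaussSum_one_right hne]
      simp
    · by_cases h2 : χ ^ ν = 1
      · rw [h2, gaussSum_one_left (hprim h1)]
        simpa using hs1
      · have hp2 : (ψ.mulShift (ν : ZMod (n + 1))).IsPrimitive :=
          AddChar.IsPrimitive.of_ne_one (hprim h1)
        have h3 := gaussSum_mul_gaussSum_eq_card h2 hp2
        rw [← star_gaussSum_eq, ← starRingEnd_apply, Complex.mul_conj', ZMod.card] at h3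
        apply Real.le_sqrt_of_sq_le
        apply le_of_eq
        exact_mod_cast h3

theorem andersson_bounds (n : ℕ) (h : (n + 1).Prime) :
    Real.sqrt n ≤
      sInf {M : ℝ | ∃ z : Fin n → ℂ, (∀ k, 1 ≤ ‖z k‖) ∧
        M = sSup {y : ℝ | ∃ ν ∈ Finset.Icc 1 (n ^ 2), y = ‖∑ k, z k ^ ν‖}} ∧
    sInf {M : ℝ | ∃ z : Fin n → ℂ, (∀ k, 1 ≤ ‖z k‖) ∧
        M = sSup {y : ℝ | ∃ ν ∈ Finset.Icc 1 (n ^ 2), y = ‖∑ k, z k ^ ν‖}} ≤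
      Real.sqrt ((n : ℝ) + 1) := by
  have hn : 1 ≤ n := by
    rcases Nat.eq_zero_or_pos n with rfl | h0
    · exact absurd h (by decide)
    · exact h0
  have low : ∀ M ∈ {M : ℝ | ∃ z : Fin n → ℂ, (∀ k, 1 ≤ ‖z k‖) ∧
        M = sSup {y : ℝ | ∃ ν ∈ Finset.Icc 1 (n ^ 2), y = ‖∑ k, z k ^ ν‖}},
      Real.sqrt n ≤ M := by
    rintro M ⟨z, hz, rfl⟩
    obtain ⟨ν, hν, hle⟩ := lower_aux n hn z hz
    refine hle.trans (le_csSup ?_ ⟨ν, hν, rfl⟩)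
    have : {y : ℝ | ∃ ν ∈ Finset.Icc 1 (n ^ 2), y = ‖∑ k, z k ^ ν‖}
        = (fun ν : ℕ => ‖∑ k, z k ^ ν‖) '' (Finset.Icc 1 (n ^ 2) : Finset ℕ) := by
      ext y
      simp only [Set.mem_setOf_eq, Set.mem_image, Finset.mem_coe, eq_comm]
    rw [this]
    exact ((Finset.finite_toSet _).image _).bddAbove
  obtain ⟨z, hz, hub⟩ := upper_aux n h
  refine ⟨le_csInf ⟨_, z, hz, rfl⟩ low, (csInf_le ⟨_, low⟩ ⟨z, hz, rfl⟩).trans ?_⟩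
  apply csSup_le
  · exact ⟨_, 1, Finset.mem_Icc.2 ⟨le_rfl, Nat.one_le_pow _ _ hn⟩, rfl⟩
  · rintro y ⟨ν, hν, rfl⟩
    exact hub ν hν
end

section
/- Let n ≥ 3 be a prime power. Then inf over (z_1,...,z_n) with |z_k| ≥ 1 of max_{ν=1,...,n²−n+1} |∑_{k=1}^n z_k^ν| ≥ √n. -/
lemma exists_psum_nonneg {σ : Type} [Fintype σ] [DecidableEq σ] (w : σ → ℂ) (t : ℕ → ℝ)
    (h : ∀ ν, ∑ i, w i ^ ν = (t ν : ℂ)) :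
    ∃ ν ∈ Finset.Icc 1 (Fintype.card σ + 1), 0 ≤ t ν := by
  by_contra! hneg
  set E : ℕ → ℂ := fun k => MvPolynomial.aeval w (MvPolynomial.esymm σ ℂ k) with hE
  have newton : ∀ k : ℕ, (k : ℂ) * ((-1) ^ k * E k) =
      ∑ a ∈ Finset.HasAntidiagonal.antidiagonal k with a.1 < k, ((-1) ^ a.1 * E a.1) * (-(t a.2 : ℂ)) := by
    intro k
    have := congrArg (MvPolynomial.aeval w) (MvPolynomial.mul_esymm_eq_sum σ ℂ k)
    simp only [map_mul, map_natCast, map_pow, map_neg, map_one, map_sum, MvPolynomial.psum,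
      MvPolynomial.aeval_X, h] at this
    have h2 : ((-1 : ℂ) ^ k) * (-1) ^ (k + 1) = -1 := by
      rw [← pow_add, Odd.neg_one_pow ⟨k, by ring⟩]
    calc (k : ℂ) * ((-1) ^ k * E k) = (-1) ^ k * ((k : ℂ) * E k) := by ring
      _ = _ := by
        rw [hE]
        simp only
        rw [this, ← mul_assoc, h2, Finset.mul_sum]
        refine Finset.sum_congr rfl fun a _ => ?_
        ring
  have pos : ∀ k : ℕ, k ≤ Fintype.card σ + 1 → ∃ r : ℝ, 0 < r ∧ (-1) ^ k * E k = (r : ℂ) := by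
    intro k
    induction k using Nat.strong_induction_on with
    | _ k ih =>
      intro hk
      rcases Nat.eq_zero_or_pos k with rfl | hk0
      · exact ⟨1, one_pos, by simp [hE]⟩
      · choose! r hr hr' using ih
        have e := newton k
        have e2 : ∑ a ∈ Finset.HasAntidiagonal.antidiagonal k with a.1 < k,
            ((-1) ^ a.1 * E a.1) * (-(t a.2 : ℂ)) =
            ((∑ a ∈ Finset.HasAntidiagonal.antidiagonal k with a.1 < k, r a.1 * (-(t a.2)) : ℝ) : ℂ) := by
          push_cast
          refine Finset.sum_congr rfl fun a ha => ?_
          have h3 := (Finset.mem_filter.1 ha).2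
          rw [hr' a.1 h3 (by omega)]
        rw [e2] at e
        have hkC : (k : ℂ) ≠ 0 := by exact_mod_cast hk0.ne'
        refine ⟨(∑ a ∈ Finset.HasAntidiagonal.antidiagonal k with a.1 < k, r a.1 * (-(t a.2))) / k, ?_, ?_⟩
        · refine div_pos (Finset.sum_pos ?_ ⟨(0, k), by simp [hk0]⟩) (by exact_mod_cast hk0)
          intro a ha
          obtain ⟨h4, h3⟩ := Finset.mem_filter.1 ha
          rw [Finset.HasAntidiagonal.mem_antidiagonal] at h4
          have := hneg a.2 (Finset.mem_Icc.2 ⟨by omega, by omega⟩)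
          exact mul_pos (hr a.1 h3 (by omega)) (by linarith)
        · rw [Complex.ofReal_div, ← e]
          push_cast
          field_simp
  obtain ⟨r, hr, hr'⟩ := pos _ le_rfl
  have h0 : E (Fintype.card σ + 1) = 0 := by
    simp only [hE, MvPolynomial.esymm]
    rw [Finset.powersetCard_eq_empty.2 (by simp)]
    simp
  rw [h0, mul_zero] at hr'
  exact hr.ne (by exact_mod_cast hr')

theorem cassels_lower_m_eq_n (n : ℕ) (hn : 3 ≤ n) (hp : IsPrimePow n)
    (z : Fin n → ℂ) (hz : ∀ k, 1 ≤ ‖z k‖) :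
    ∃ ν ∈ Finset.Icc 1 (n ^ 2 - n + 1), Real.sqrt n ≤ ‖∑ k, z k ^ ν‖ := by
  have key : ∀ ν : ℕ, ∑ p : {p : Fin n × Fin n // p.1 ≠ p.2},
      (z p.1.1 * (starRingEnd ℂ) (z p.1.2)) ^ ν =
      ((‖∑ k, z k ^ ν‖ ^ 2 - ∑ k, (‖z k‖ ^ 2) ^ ν : ℝ) : ℂ) := by
    intro ν
    have h1 : ((‖∑ k, z k ^ ν‖ ^ 2 : ℝ) : ℂ) =
        ∑ p : Fin n × Fin n, (z p.1 * (starRingEnd ℂ) (z p.2)) ^ ν := by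
      push_cast
      rw [← Complex.mul_conj', map_sum, Finset.sum_mul_sum, Fintype.sum_prod_type]
      simp [mul_pow]
    have h2 : ((∑ k, (‖z k‖ ^ 2) ^ ν : ℝ) : ℂ) =
        ∑ p : Fin n × Fin n with ¬ p.1 ≠ p.2, (z p.1 * (starRingEnd ℂ) (z p.2)) ^ ν := by
      rw [Finset.sum_filter, Fintype.sum_prod_type]
      push_cast
      simp [Complex.mul_conj']
    rw [Complex.ofReal_sub, h1, h2, eq_sub_iff_add_eq,
      ← Finset.sum_filter_add_sum_filter_not Finset.univ (fun p : Fin n × Fin n => p.1 ≠ p.2)]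
    congr 1
    exact (Finset.sum_subtype _ (by simp)
      (fun p : Fin n × Fin n => (z p.1 * (starRingEnd ℂ) (z p.2)) ^ ν)).symm
  obtain ⟨ν, hν, hpos⟩ := exists_psum_nonneg _ _ key
  have hc : Fintype.card {p : Fin n × Fin n // p.1 ≠ p.2} = n ^ 2 - n := by
    rw [Fintype.card_subtype]
    have := Finset.offDiag_card (Finset.univ : Finset (Fin n))
    rw [Finset.card_univ, Fintype.card_fin] at this
    rw [pow_two, ← this]
    congr 1
    ext p
    simp
  rw [hc] at hν
  refine ⟨ν, hν, ?_⟩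
  have : (n : ℝ) ≤ ∑ k, (‖z k‖ ^ 2) ^ ν := by
    calc (n : ℝ) = ∑ k : Fin n, (1 : ℝ) := by simp
      _ ≤ _ := Finset.sum_le_sum fun k _ => one_le_pow₀ (one_le_pow₀ (hz k))
  exact Real.sqrt_le_iff.2 ⟨norm_nonneg _, by linarith⟩
end
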